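/- arXiv:2605.17665 — 9 statements merged into one kernel-verified Lean document; each statement's English description precedes it below -/
import Mathlib

section
/- Let X ⊆ ℝ^d be a nonempty convex set, let f : X → X, let ε ≥ 0, and let μ be a finitely-supported probability distribution on X × X. Suppose that (i) E_{(x,y)∼μ} ‖x − E[y|x]‖₂² ≤ ε, and (ii) E_{(x,y)∼μ} ‖y − E[f(x)|y]‖₂² ≤ ε, where E[y|x] denotes the conditional mean of the second coordinate given that the first coordinate equals x, and E[f(x)|y] denotes the conditional mean of f applied to the first coordinate given that the second coordinate equals y. Then for every convex function Q : ℝ^d → ℝ that is 1-Lipschitz with respect to the Euclidean norm, E_{(x,y)∼μ}[Q(x) − Q(f(x))] ≤ 2√ε. -/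
open Classical in
/-- Jensen's inequality for conditional means over the fibres of `key`. -/
lemma sum_comp_fiber_mean_le {ι E : Type*} [AddCommGroup E] [Module ℝ E]
    {s : Finset ι} {w : ι → ℝ} (hw : ∀ i ∈ s, 0 ≤ w i) (key v : ι → E)
    {Q : E → ℝ} (hQ : ConvexOn ℝ Set.univ Q) :
    ∑ i ∈ s, w i * Q ((∑ j ∈ s.filter (fun j => key j = key i), w j)⁻¹ •
      ∑ j ∈ s.filter (fun j => key j = key i), w j • v j) ≤ ∑ i ∈ s, w i * Q (v i) := by
  have maps : ∀ i ∈ s, key i ∈ s.image key := fun i hi => Finset.mem_image_of_mem key hi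
  rw [← Finset.sum_fiberwise_of_maps_to maps, ← Finset.sum_fiberwise_of_maps_to maps]
  refine Finset.sum_le_sum fun k _ => ?_
  set t := s.filter (fun j => key j = k) with ht
  have hwt : ∀ i ∈ t, 0 ≤ w i := fun i hi => hw i (Finset.mem_filter.1 hi).1
  have fiber : ∑ i ∈ t, w i * Q ((∑ j ∈ s.filter (fun j => key j = key i), w j)⁻¹ •
      ∑ j ∈ s.filter (fun j => key j = key i), w j • v j)
      = (∑ i ∈ t, w i) * Q ((∑ j ∈ t, w j)⁻¹ • ∑ j ∈ t, w j • v j) := by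
    rw [Finset.sum_mul]
    refine Finset.sum_congr rfl fun i hi => ?_
    rw [(Finset.mem_filter.1 hi).2]
  rw [fiber]
  rcases (Finset.sum_nonneg hwt).eq_or_lt with h0 | hpos
  · have hz := (Finset.sum_eq_zero_iff_of_nonneg hwt).1 h0.symm
    rw [← h0, zero_mul, Finset.sum_eq_zero]
    intro i hi
    rw [hz i hi, zero_mul]
  · have hJ := hQ.map_centerMass_le hwt hpos (p := v) fun _ _ => Set.mem_univ _
    simp only [Finset.centerMass, Function.comp_apply, smul_eq_mul] at hJ
    rwa [le_inv_mul_iff₀ hpos] at hJ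

lemma sum_mul_le_sqrt_of_sum_mul_sq_le {ι : Type*} {s : Finset ι} {w n : ι → ℝ} {ε : ℝ}
    (hw : ∀ i ∈ s, 0 ≤ w i) (hw1 : ∑ i ∈ s, w i = 1) (h : ∑ i ∈ s, w i * n i ^ 2 ≤ ε) :
    ∑ i ∈ s, w i * n i ≤ √ε := by
  refine Real.le_sqrt_of_sq_le (le_trans ?_ h)
  have hCS := Finset.sum_sq_le_sum_mul_sum_of_sq_le_mul s (r := fun i => w i * n i) hw
    (fun i hi => mul_nonneg (hw i hi) (sq_nonneg (n i))) fun i _ => le_of_eq (by ring)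
  rwa [hw1, one_mul] at hCS

/-- If the conditional mean of `v` given `key` is close to `key` in mean square, then the
expectation of a convex `1`-Lipschitz function at `key` barely exceeds that at `v`. -/
lemma sum_sub_le_sqrt_of_fiber_mean {ι E : Type*} [NormedAddCommGroup E] [NormedSpace ℝ E]
    {s : Finset ι} {w : ι → ℝ} (hw : ∀ i ∈ s, 0 ≤ w i) (hw1 : ∑ i ∈ s, w i = 1)
    {key v m : ι → E} {Q : E → ℝ} (hQ : LipschitzWith 1 Q) {ε : ℝ}
    (hm : ∑ i ∈ s, w i * Q (m i) ≤ ∑ i ∈ s, w i * Q (v i))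
    (h : ∑ i ∈ s, w i * ‖key i - m i‖ ^ 2 ≤ ε) :
    ∑ i ∈ s, w i * (Q (key i) - Q (v i)) ≤ √ε := by
  have hn := sum_mul_le_sqrt_of_sum_mul_sq_le hw hw1 h
  have hL : ∑ i ∈ s, w i * (Q (key i) - Q (m i)) ≤ ∑ i ∈ s, w i * ‖key i - m i‖ := by
    refine Finset.sum_le_sum fun i hi => mul_le_mul_of_nonneg_left ?_ (hw i hi)
    have := hQ.dist_le_mul (key i) (m i)
    rw [Real.dist_eq, dist_eq_norm, NNReal.coe_one, one_mul] at this
    exact (le_abs_self _).trans this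
  simp only [mul_sub, Finset.sum_sub_distrib] at hL ⊢
  linarith


open scoped RealInnerProductSpace

/- `condMeanSnd s w p x` is the conditional mean of the second coordinate of `p i`, under the
finitely-supported distribution given by index set `s` and weights `w`, given that the first
coordinate equals `x`. -/
open Classical in
noncomputable def condMeanSnd {ι E : Type*} [AddCommGroup E] [Module ℝ E]
    (s : Finset ι) (w : ι → ℝ) (p : ι → E × E) (x : E) : E :=
  (∑ i ∈ s.filter (fun i => (p i).1 = x), w i)⁻¹ •
    ∑ i ∈ s.filter (fun i => (p i).1 = x), w i • (p i).2

/- `condMeanFstApp s w p f y` is the conditional mean of `f` applied to the first coordinate of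
`p i`, under the finitely-supported distribution given by index set `s` and weights `w`, given
that the second coordinate equals `y`. -/
open Classical in
noncomputable def condMeanFstApp {ι E : Type*} [AddCommGroup E] [Module ℝ E]
    (s : Finset ι) (w : ι → ℝ) (p : ι → E × E) (f : E → E) (y : E) : E :=
  (∑ i ∈ s.filter (fun i => (p i).2 = y), w i)⁻¹ •
    ∑ i ∈ s.filter (fun i => (p i).2 = y), w i • f (p i).1

theorem stmt0 {d : ℕ} {ι : Type*}
    (X : Set (EuclideanSpace ℝ (Fin d))) (hXne : X.Nonempty) (hXconv : Convex ℝ X)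
    (f : EuclideanSpace ℝ (Fin d) → EuclideanSpace ℝ (Fin d)) (hf : ∀ x ∈ X, f x ∈ X)
    (ε : ℝ) (hε : 0 ≤ ε)
    (s : Finset ι) (w : ι → ℝ)
    (p : ι → EuclideanSpace ℝ (Fin d) × EuclideanSpace ℝ (Fin d))
    (hw : ∀ i ∈ s, 0 ≤ w i) (hw1 : ∑ i ∈ s, w i = 1)
    (hpX : ∀ i ∈ s, (p i).1 ∈ X ∧ (p i).2 ∈ X)
    (h1 : ∑ i ∈ s, w i * ‖(p i).1 - condMeanSnd s w p (p i).1‖ ^ 2 ≤ ε)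
    (h2 : ∑ i ∈ s, w i * ‖(p i).2 - condMeanFstApp s w p f (p i).2‖ ^ 2 ≤ ε) :
    ∀ Q : EuclideanSpace ℝ (Fin d) → ℝ, ConvexOn ℝ Set.univ Q → LipschitzWith 1 Q →
      ∑ i ∈ s, w i * (Q (p i).1 - Q (f (p i).1)) ≤ 2 * Real.sqrt ε := by
  intro Q hQ hL
  have hxy := sum_sub_le_sqrt_of_fiber_mean hw hw1 hL
    (sum_comp_fiber_mean_le hw (fun i => (p i).1) (fun i => (p i).2) hQ) h1
  have hyf := sum_sub_le_sqrt_of_fiber_mean hw hw1 hL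
    (sum_comp_fiber_mean_le hw (fun i => (p i).2) (fun i => f (p i).1) hQ) h2
  simp only [mul_sub, Finset.sum_sub_distrib] at hxy hyf ⊢
  linarith
end

section
/- Let X ⊆ ℝ^d be a nonempty convex set, let f : X → X, let ε ≥ 0 and γ > 0, and let μ be a finitely-supported probability distribution on X × X. Suppose that (i) E_{(x,y)∼μ} ‖x − E[y|x]‖₂² ≤ ε, and (ii) E_{(x,y)∼μ} ‖y − E[f(x)|y]‖₂² ≤ ε. Let Q : ℝ^d → ℝ be convex and 1-Lipschitz with respect to the Euclidean norm, and suppose Q(f(x)) ≤ (1 − γ)·Q(x) for every x ∈ X. Then E_{(x,y)∼μ} Q(x) ≤ 2√ε / γ. -/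
open scoped RealInnerProductSpace

open Classical in
/-- Conditional Jensen inequality for a finitely-supported distribution: averaging a convex
function over the conditional means of `h` given `g` is at most averaging it over `h`. -/
theorem ConvexOn.sum_map_fiber_mean_le {ι κ E : Type*} [AddCommGroup E] [Module ℝ E]
    {Q : E → ℝ} (hQ : ConvexOn ℝ Set.univ Q) (s : Finset ι) (w : ι → ℝ)
    (hw : ∀ i ∈ s, 0 ≤ w i) (g : ι → κ) (h : ι → E) :
    ∑ i ∈ s, w i * Q ((∑ j ∈ s.filter (fun j => g j = g i), w j)⁻¹ •
      ∑ j ∈ s.filter (fun j => g j = g i), w j • h j) ≤ ∑ i ∈ s, w i * Q (h i) := by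
  have hmaps : ∀ i ∈ s, g i ∈ s.image g := fun i hi => Finset.mem_image_of_mem g hi
  rw [← Finset.sum_fiberwise_of_maps_to hmaps, ← Finset.sum_fiberwise_of_maps_to hmaps]
  refine Finset.sum_le_sum fun z _ => ?_
  have hw' : ∀ i ∈ s.filter (fun j => g j = z), 0 ≤ w i := fun i hi =>
    hw i (Finset.mem_filter.1 hi).1
  rw [Finset.sum_congr rfl (g := fun i => w i * Q ((∑ j ∈ s.filter (fun j => g j = z), w j)⁻¹ •
      ∑ j ∈ s.filter (fun j => g j = z), w j • h j))
    fun i hi => by rw [(Finset.mem_filter.1 hi).2], ← Finset.sum_mul]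
  rcases (Finset.sum_nonneg hw').eq_or_lt with h0 | hpos
  · have hzero := (Finset.sum_eq_zero_iff_of_nonneg hw').1 h0.symm
    rw [← h0, zero_mul, Finset.sum_eq_zero fun i hi => by rw [hzero i hi, zero_mul]]
  · have key := hQ.map_centerMass_le hw' hpos (p := h) fun _ _ => Set.mem_univ _
    simp only [Finset.centerMass, smul_eq_mul, Function.comp_apply] at key
    rwa [le_inv_mul_iff₀ hpos] at key

open Classical in
/-- If `g` is within mean square distance `ε` of the conditional mean of `h` given `g`, then the
mean of a convex `1`-Lipschitz function of `g` exceeds that of `h` by at most `√ε`. -/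
theorem ConvexOn.sum_map_le_sum_map_add_sqrt {ι E : Type*} [NormedAddCommGroup E]
    [NormedSpace ℝ E] {Q : E → ℝ} (hQ : ConvexOn ℝ Set.univ Q) (hQlip : LipschitzWith 1 Q)
    (s : Finset ι) (w : ι → ℝ) (hw : ∀ i ∈ s, 0 ≤ w i) (hw1 : ∑ i ∈ s, w i = 1)
    (g h : ι → E) {ε : ℝ}
    (hε : ∑ i ∈ s, w i * ‖g i - (∑ j ∈ s.filter (fun j => g j = g i), w j)⁻¹ •
      ∑ j ∈ s.filter (fun j => g j = g i), w j • h j‖ ^ 2 ≤ ε) :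
    ∑ i ∈ s, w i * Q (g i) ≤ ∑ i ∈ s, w i * Q (h i) + √ε := by
  have hJensen := hQ.sum_map_fiber_mean_le s w hw g h
  set m : ι → E := fun i => (∑ j ∈ s.filter (fun j => g j = g i), w j)⁻¹ •
      ∑ j ∈ s.filter (fun j => g j = g i), w j • h j
  have hdist : ∑ i ∈ s, w i * ‖g i - m i‖ ≤ √ε :=
    Real.le_sqrt_of_sq_le ((Real.pow_arith_mean_le_arith_mean_pow s w _ hw hw1
      (fun _ _ => norm_nonneg _) 2).trans hε)
  have hlip : ∑ i ∈ s, w i * Q (g i) ≤ ∑ i ∈ s, (w i * Q (m i) + w i * ‖g i - m i‖) := by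
    refine Finset.sum_le_sum fun i hi => ?_
    rw [← mul_add]
    refine mul_le_mul_of_nonneg_left ?_ (hw i hi)
    have hd := hQlip.dist_le_mul (g i) (m i)
    rw [NNReal.coe_one, one_mul, dist_eq_norm, dist_eq_norm, Real.norm_eq_abs] at hd
    linarith [le_abs_self (Q (g i) - Q (m i))]
  rw [Finset.sum_add_distrib] at hlip
  linarith

theorem stmt1 {d : ℕ} {ι : Type*}
    (X : Set (EuclideanSpace ℝ (Fin d))) (hXne : X.Nonempty) (hXconv : Convex ℝ X)
    (f : EuclideanSpace ℝ (Fin d) → EuclideanSpace ℝ (Fin d)) (hf : ∀ x ∈ X, f x ∈ X)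
    (ε γ : ℝ) (hε : 0 ≤ ε) (hγ : 0 < γ)
    (s : Finset ι) (w : ι → ℝ)
    (p : ι → EuclideanSpace ℝ (Fin d) × EuclideanSpace ℝ (Fin d))
    (hw : ∀ i ∈ s, 0 ≤ w i) (hw1 : ∑ i ∈ s, w i = 1)
    (hpX : ∀ i ∈ s, (p i).1 ∈ X ∧ (p i).2 ∈ X)
    (h1 : ∑ i ∈ s, w i * ‖(p i).1 - condMeanSnd s w p (p i).1‖ ^ 2 ≤ ε)
    (h2 : ∑ i ∈ s, w i * ‖(p i).2 - condMeanFstApp s w p f (p i).2‖ ^ 2 ≤ ε)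
    (Q : EuclideanSpace ℝ (Fin d) → ℝ)
    (hQconv : ConvexOn ℝ Set.univ Q) (hQlip : LipschitzWith 1 Q)
    (hcontr : ∀ x ∈ X, Q (f x) ≤ (1 - γ) * Q x) :
    ∑ i ∈ s, w i * Q (p i).1 ≤ 2 * Real.sqrt ε / γ := by
  have hx := hQconv.sum_map_le_sum_map_add_sqrt hQlip s w hw hw1
    (fun i => (p i).1) (fun i => (p i).2) h1
  have hy := hQconv.sum_map_le_sum_map_add_sqrt hQlip s w hw hw1
    (fun i => (p i).2) (fun i => f (p i).1) h2
  have hfx : ∑ i ∈ s, w i * Q (f (p i).1) ≤ (1 - γ) * ∑ i ∈ s, w i * Q (p i).1 := by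
    rw [Finset.mul_sum]
    refine Finset.sum_le_sum fun i hi => ?_
    rw [mul_left_comm]
    exact mul_le_mul_of_nonneg_left (hcontr _ (hpX i hi).1) (hw i hi)
  rw [le_div_iff₀ hγ]
  linarith
end

section
/- Let X ⊆ ℝ^d be a nonempty convex set, let f : X → X, let ε ≥ 0 and γ ∈ (0,1], and let μ be a finitely-supported probability distribution on X × X. Suppose that (i) for every function φ : X → X, E_{(x,y)∼μ}[‖x − y‖₂² − ‖φ(x) − y‖₂²] ≤ ε, and (ii) for every function ψ : X → X, E_{(x,y)∼μ}[‖y − f(x)‖₂² − ‖ψ(y) − f(x)‖₂²] ≤ ε. Let Q : ℝ^d → ℝ be convex and 1-Lipschitz with respect to the Euclidean norm, and suppose Q(f(x)) ≤ (1 − γ)·Q(x) for every x ∈ X. Then E_{(x,y)∼μ} Q(x) ≤ 2√ε / γ. -/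
open scoped RealInnerProductSpace

section Barycenter

variable {E ι : Type*} [NormedAddCommGroup E] [InnerProductSpace ℝ E]

/-- The drop in mean squared distance on moving the reference point to the barycenter. -/
theorem sum_mul_norm_sub_sq_sub_centerMass (t : Finset ι) (w : ι → ℝ) (b : ι → E) (z : E)
    (hM : 0 < ∑ i ∈ t, w i) :
    ∑ i ∈ t, w i * (‖z - b i‖ ^ 2 - ‖t.centerMass w b - b i‖ ^ 2) =
      (∑ i ∈ t, w i) * ‖z - t.centerMass w b‖ ^ 2 := by
  set c := t.centerMass w b with hc
  have h0 : ∑ i ∈ t, w i • (c - b i) = 0 := by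
    simp_rw [smul_sub]
    rw [Finset.sum_sub_distrib, ← Finset.sum_smul, hc, Finset.centerMass, smul_smul,
      mul_inv_cancel₀ hM.ne', one_smul, sub_self]
  have h1 : ∑ i ∈ t, w i * ⟪z - c, c - b i⟫ = 0 := by
    simp_rw [← real_inner_smul_right]
    rw [← inner_sum, h0, inner_zero_right]
  have h2 : ∀ i, w i * (‖z - b i‖ ^ 2 - ‖c - b i‖ ^ 2) =
      w i * ‖z - c‖ ^ 2 + 2 * (w i * ⟪z - c, c - b i⟫) := fun i => by
    have h := norm_add_sq_real (z - c) (c - b i)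
    rw [sub_add_sub_cancel] at h
    rw [h]
    ring
  simp_rw [h2]
  rw [Finset.sum_add_distrib, ← Finset.mul_sum, h1, Finset.sum_mul]
  ring

open Classical in
/-- If no map `φ` preserving the convex set `X` brings `φ ∘ a` closer to `b` than `a` by more than
`ε` in mean square, then the mean of a convex `1`-Lipschitz function over `a` exceeds its mean
over `b` by at most `√ε`. -/
theorem sum_mul_le_add_sqrt_of_deviation {X : Set E} (hX : Convex ℝ X) {ε : ℝ}
    {s : Finset ι} {w : ι → ℝ} {a b : ι → E}
    (hw : ∀ i ∈ s, 0 ≤ w i) (hw1 : ∑ i ∈ s, w i = 1) (hb : ∀ i ∈ s, b i ∈ X)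
    (hdev : ∀ φ : E → E, (∀ x ∈ X, φ x ∈ X) →
      ∑ i ∈ s, w i * (‖a i - b i‖ ^ 2 - ‖φ (a i) - b i‖ ^ 2) ≤ ε)
    {Q : E → ℝ} (hQ : ConvexOn ℝ Set.univ Q) (hQlip : LipschitzWith 1 Q) :
    ∑ i ∈ s, w i * Q (a i) ≤ ∑ i ∈ s, w i * Q (b i) + √ε := by
  let t : E → Finset ι := fun z => s.filter fun i => a i = z
  let φ : E → E := fun z => if 0 < ∑ i ∈ t z, w i then (t z).centerMass w b else z
  have hwt : ∀ z, ∀ i ∈ t z, 0 ≤ w i := fun z i hi => hw i (Finset.mem_filter.1 hi).1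
  have hφ : ∀ x ∈ X, φ x ∈ X := fun x hx => by
    by_cases h : 0 < ∑ i ∈ t x, w i
    · simp only [φ, if_pos h]
      exact hX.centerMass_mem (hwt x) h fun i hi => hb i (Finset.mem_filter.1 hi).1
    · simpa only [φ, if_neg h] using hx
  have hfib : ∀ g : ι → ℝ, ∑ i ∈ s, g i = ∑ z ∈ s.image a, ∑ i ∈ t z, g i := fun g =>
    (Finset.sum_fiberwise_of_maps_to (fun i hi => Finset.mem_image_of_mem a hi) g).symm
  have hfst : ∀ z, ∀ i ∈ t z, a i = z := fun z i hi => (Finset.mem_filter.1 hi).2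
  have hzero : ∀ z, ¬ 0 < ∑ i ∈ t z, w i → ∀ i ∈ t z, w i = 0 := fun z h =>
    (Finset.sum_eq_zero_iff_of_nonneg (hwt z)).1
      (le_antisymm (not_lt.1 h) (Finset.sum_nonneg (hwt z)))
  have hsq : ∑ i ∈ s, w i * ‖a i - φ (a i)‖ ^ 2 ≤ ε := by
    refine le_trans (le_of_eq ?_) (hdev φ hφ)
    rw [hfib, hfib]
    refine Finset.sum_congr rfl fun z _ => ?_
    by_cases h : 0 < ∑ i ∈ t z, w i
    · have hφz : φ z = (t z).centerMass w b := if_pos h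
      have key := sum_mul_norm_sub_sq_sub_centerMass (t z) w b z h
      rw [← hφz, Finset.sum_mul] at key
      rw [Finset.sum_congr rfl fun i hi => by rw [hfst z i hi], ← key]
      exact Finset.sum_congr rfl fun i hi => by rw [hfst z i hi]
    · exact Finset.sum_congr rfl fun i hi => by rw [hzero z h i hi, zero_mul, zero_mul]
  have hjensen : ∑ i ∈ s, w i * Q (φ (a i)) ≤ ∑ i ∈ s, w i * Q (b i) := by
    rw [hfib, hfib]
    refine Finset.sum_le_sum fun z _ => ?_
    by_cases h : 0 < ∑ i ∈ t z, w i
    · have hφz : φ z = (t z).centerMass w b := if_pos h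
      have key := hQ.map_centerMass_le (p := b) (hwt z) h fun i _ => Set.mem_univ _
      rw [← hφz, Finset.centerMass, smul_eq_mul, ← div_eq_inv_mul, le_div_iff₀ h, mul_comm,
        Finset.sum_mul] at key
      rw [Finset.sum_congr rfl fun i hi => by rw [hfst z i hi]]
      exact key
    · exact Finset.sum_le_sum fun i hi => by rw [hzero z h i hi, zero_mul, zero_mul]
  have hmean : ∑ i ∈ s, w i * ‖a i - φ (a i)‖ ≤ √ε :=
    Real.le_sqrt_of_sq_le <| (Real.pow_arith_mean_le_arith_mean_pow s w _ hw hw1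
      (fun _ _ => norm_nonneg _) 2).trans hsq
  calc ∑ i ∈ s, w i * Q (a i)
      ≤ ∑ i ∈ s, (w i * Q (φ (a i)) + w i * ‖a i - φ (a i)‖) := by
        refine Finset.sum_le_sum fun i hi => ?_
        rw [← mul_add]
        refine mul_le_mul_of_nonneg_left ?_ (hw i hi)
        simpa [dist_eq_norm] using hQlip.le_add_mul (a i) (φ (a i))
    _ ≤ _ := by
        rw [Finset.sum_add_distrib]
        exact add_le_add hjensen hmean

end Barycenter

theorem stmt4 {d : ℕ} {ι : Type*}
    (X : Set (EuclideanSpace ℝ (Fin d))) (hXne : X.Nonempty) (hXconv : Convex ℝ X)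
    (f : EuclideanSpace ℝ (Fin d) → EuclideanSpace ℝ (Fin d)) (hf : ∀ x ∈ X, f x ∈ X)
    (ε γ : ℝ) (hε : 0 ≤ ε) (hγ0 : 0 < γ) (hγ1 : γ ≤ 1)
    (s : Finset ι) (w : ι → ℝ)
    (p : ι → EuclideanSpace ℝ (Fin d) × EuclideanSpace ℝ (Fin d))
    (hw : ∀ i ∈ s, 0 ≤ w i) (hw1 : ∑ i ∈ s, w i = 1)
    (hpX : ∀ i ∈ s, (p i).1 ∈ X ∧ (p i).2 ∈ X)
    (hdev1 : ∀ φ : EuclideanSpace ℝ (Fin d) → EuclideanSpace ℝ (Fin d),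
      (∀ x ∈ X, φ x ∈ X) →
      ∑ i ∈ s, w i * (‖(p i).1 - (p i).2‖ ^ 2 - ‖φ (p i).1 - (p i).2‖ ^ 2) ≤ ε)
    (hdev2 : ∀ ψ : EuclideanSpace ℝ (Fin d) → EuclideanSpace ℝ (Fin d),
      (∀ x ∈ X, ψ x ∈ X) →
      ∑ i ∈ s, w i * (‖(p i).2 - f (p i).1‖ ^ 2 - ‖ψ (p i).2 - f (p i).1‖ ^ 2) ≤ ε)
    (Q : EuclideanSpace ℝ (Fin d) → ℝ)
    (hQconv : ConvexOn ℝ Set.univ Q) (hQlip : LipschitzWith 1 Q)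
    (hcontr : ∀ x ∈ X, Q (f x) ≤ (1 - γ) * Q x) :
    ∑ i ∈ s, w i * Q (p i).1 ≤ 2 * Real.sqrt ε / γ := by
  have h1 := sum_mul_le_add_sqrt_of_deviation hXconv hw hw1 (fun i hi => (hpX i hi).2) hdev1
    hQconv hQlip
  have h2 := sum_mul_le_add_sqrt_of_deviation hXconv hw hw1
    (fun i hi => hf _ (hpX i hi).1) hdev2 hQconv hQlip
  have h3 : ∑ i ∈ s, w i * Q (f (p i).1) ≤ (1 - γ) * ∑ i ∈ s, w i * Q (p i).1 := by
    rw [Finset.mul_sum]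
    refine Finset.sum_le_sum fun i hi => ?_
    rw [mul_left_comm]
    exact mul_le_mul_of_nonneg_left (hcontr _ (hpX i hi).1) (hw i hi)
  rw [le_div_iff₀ hγ0]
  linarith
end

section
/- Let X ⊆ ℝ^d be a nonempty set, let f : X → X, let ε ≥ 0 and γ > 0, and let μ be a finitely-supported probability distribution on X. Suppose that for every concave 1-Lipschitz function u : X → [0,1], E_{x∼μ}[u(f(x)) − u(x)] ≤ ε. Let Q : X → [0,1] be convex and 1-Lipschitz with respect to the Euclidean norm, and suppose Q(f(x)) ≤ (1 − γ)·Q(x) for every x ∈ X. Then E_{x∼μ} Q(x) ≤ ε/γ. -/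
theorem stmt5 {d : ℕ} {ι : Type*}
    (X : Set (EuclideanSpace ℝ (Fin d))) (hXne : X.Nonempty)
    (f : EuclideanSpace ℝ (Fin d) → EuclideanSpace ℝ (Fin d)) (hf : ∀ x ∈ X, f x ∈ X)
    (ε γ : ℝ) (hε : 0 ≤ ε) (hγ : 0 < γ)
    (s : Finset ι) (w : ι → ℝ) (p : ι → EuclideanSpace ℝ (Fin d))
    (hw : ∀ i ∈ s, 0 ≤ w i) (hw1 : ∑ i ∈ s, w i = 1)
    (hpX : ∀ i ∈ s, p i ∈ X)
    (hcefp : ∀ u : EuclideanSpace ℝ (Fin d) → ℝ,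
      ConcaveOn ℝ X u → LipschitzOnWith 1 u X → (∀ x ∈ X, u x ∈ Set.Icc (0 : ℝ) 1) →
      ∑ i ∈ s, w i * (u (f (p i)) - u (p i)) ≤ ε)
    (Q : EuclideanSpace ℝ (Fin d) → ℝ)
    (hQconv : ConvexOn ℝ X Q) (hQlip : LipschitzOnWith 1 Q X)
    (hQ01 : ∀ x ∈ X, Q x ∈ Set.Icc (0 : ℝ) 1)
    (hcontr : ∀ x ∈ X, Q (f x) ≤ (1 - γ) * Q x) :
    ∑ i ∈ s, w i * Q (p i) ≤ ε / γ := by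
  have hLip : LipschitzOnWith 1 (fun x => 1 - Q x) X := by
    refine LipschitzOnWith.of_dist_le_mul fun x hx y hy => ?_
    rw [dist_sub_left]
    exact hQlip.dist_le_mul x hx y hy
  have hdrop := hcefp (fun x => 1 - Q x) ((concaveOn_const 1 hQconv.1).sub hQconv) hLip
    fun x hx => ⟨by linarith [(hQ01 x hx).2], by linarith [(hQ01 x hx).1]⟩
  rw [le_div_iff₀ hγ, Finset.sum_mul]
  refine le_trans (Finset.sum_le_sum fun i hi => ?_) hdrop
  rw [mul_assoc]
  exact mul_le_mul_of_nonneg_left (by linarith [hcontr (p i) (hpX i hi)]) (hw i hi)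
end

section
/- Let N : ℝ^d → ℝ be a seminorm, let X ⊆ ℝ^d be nonempty, let γ ∈ (0,1] and ε ≥ 0, and let f : X → X satisfy N(f(x) − f(y)) ≤ (1 − γ)·N(x − y) for all x, y ∈ X. Let μ be a finitely-supported probability distribution on X × X such that E_{(x,y)∼μ}[(N(x − y) − N(f(x) − y)) + (N(y − f(x)) − N(f(y) − f(x)))] ≤ ε. Then E_{(x,y)∼μ} N(x − y) ≤ ε/γ. -/
theorem stmt6 {d : ℕ} {ι : Type*}
    (N : Seminorm ℝ (EuclideanSpace ℝ (Fin d)))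
    (X : Set (EuclideanSpace ℝ (Fin d))) (hXne : X.Nonempty)
    (γ ε : ℝ) (hγ0 : 0 < γ) (hγ1 : γ ≤ 1) (hε : 0 ≤ ε)
    (f : EuclideanSpace ℝ (Fin d) → EuclideanSpace ℝ (Fin d)) (hf : ∀ x ∈ X, f x ∈ X)
    (hcontr : ∀ x ∈ X, ∀ y ∈ X, N (f x - f y) ≤ (1 - γ) * N (x - y))
    (s : Finset ι) (w : ι → ℝ)
    (p : ι → EuclideanSpace ℝ (Fin d) × EuclideanSpace ℝ (Fin d))
    (hw : ∀ i ∈ s, 0 ≤ w i) (hw1 : ∑ i ∈ s, w i = 1)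
    (hpX : ∀ i ∈ s, (p i).1 ∈ X ∧ (p i).2 ∈ X)
    (hdev : ∑ i ∈ s, w i *
      ((N ((p i).1 - (p i).2) - N (f (p i).1 - (p i).2)) +
        (N ((p i).2 - f (p i).1) - N (f (p i).2 - f (p i).1))) ≤ ε) :
    ∑ i ∈ s, w i * N ((p i).1 - (p i).2) ≤ ε / γ := by
  rw [le_div_iff₀ hγ0, Finset.sum_mul]
  refine le_trans (Finset.sum_le_sum fun i hi => ?_) hdev
  rw [mul_assoc]
  refine mul_le_mul_of_nonneg_left ?_ (hw i hi)
  have h := hcontr _ (hpX i hi).1 _ (hpX i hi).2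
  rw [map_sub_rev N (f (p i).1) (f (p i).2)] at h
  rw [map_sub_rev N (f (p i).1) (p i).2]
  linarith
end

section
/- Let N : ℝ^d → ℝ be a seminorm, let X ⊆ ℝ^d be nonempty, let γ ∈ (0,1] and ε ≥ 0, and let f : X → X satisfy N(f(x) − f(y)) ≤ (1 − γ)·N(x − y) for all x, y ∈ X. Let μ be a finitely-supported probability distribution on X × X such that (i) E_{(x,y)∼μ}[(N(x − y) − N(f(x) − y)) + (N(y − f(x)) − N(f(y) − f(x)))] ≤ ε, and (ii) E_{(x,y)∼μ}[N(y − f(x)) − N(f(y) − f(x))] ≤ ε. Then E_{(x,y)∼μ} N(y − f(y)) ≤ 3ε/γ. -/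
theorem stmt7 {d : ℕ} {ι : Type*}
    (N : Seminorm ℝ (EuclideanSpace ℝ (Fin d)))
    (X : Set (EuclideanSpace ℝ (Fin d))) (hXne : X.Nonempty)
    (γ ε : ℝ) (hγ0 : 0 < γ) (hγ1 : γ ≤ 1) (hε : 0 ≤ ε)
    (f : EuclideanSpace ℝ (Fin d) → EuclideanSpace ℝ (Fin d)) (hf : ∀ x ∈ X, f x ∈ X)
    (hcontr : ∀ x ∈ X, ∀ y ∈ X, N (f x - f y) ≤ (1 - γ) * N (x - y))
    (s : Finset ι) (w : ι → ℝ)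
    (p : ι → EuclideanSpace ℝ (Fin d) × EuclideanSpace ℝ (Fin d))
    (hw : ∀ i ∈ s, 0 ≤ w i) (hw1 : ∑ i ∈ s, w i = 1)
    (hpX : ∀ i ∈ s, (p i).1 ∈ X ∧ (p i).2 ∈ X)
    (hdev1 : ∑ i ∈ s, w i *
      ((N ((p i).1 - (p i).2) - N (f (p i).1 - (p i).2)) +
        (N ((p i).2 - f (p i).1) - N (f (p i).2 - f (p i).1))) ≤ ε)
    (hdev2 : ∑ i ∈ s, w i *
      (N ((p i).2 - f (p i).1) - N (f (p i).2 - f (p i).1)) ≤ ε) :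
    ∑ i ∈ s, w i * N ((p i).2 - f (p i).2) ≤ 3 * ε / γ := by
  have key : ∀ i ∈ s, γ * (w i * N ((p i).2 - f (p i).2)) ≤
      γ * (w i * (N ((p i).2 - f (p i).1) - N (f (p i).2 - f (p i).1))) +
        2 * (w i * ((N ((p i).1 - (p i).2) - N (f (p i).1 - (p i).2)) +
          (N ((p i).2 - f (p i).1) - N (f (p i).2 - f (p i).1)))) := by
    intro i hi
    obtain ⟨hx, hy⟩ := hpX i hi
    have hwi := hw i hi
    generalize (p i).1 = x at *
    generalize (p i).2 = y at *
    have hc := hcontr x hx y hy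
    have htri : N (y - f y) ≤ N (y - f x) + N (f y - f x) := by
      have h := map_add_le_add N (y - f x) (f x - f y)
      rwa [sub_add_sub_cancel, map_sub_rev N (f x) (f y)] at h
    rw [map_sub_rev N (f x) y]
    rw [map_sub_rev N (f x) (f y)] at hc
    have hcn : 0 ≤ N (f y - f x) := apply_nonneg N _
    have han : 0 ≤ N (x - y) := apply_nonneg N _
    have hle : N (f y - f x) ≤ N (x - y) := by nlinarith
    have hpt : γ * N (y - f y) ≤
        γ * (N (y - f x) - N (f y - f x)) + 2 * (N (x - y) - N (f y - f x)) := by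
      nlinarith [mul_le_mul_of_nonneg_left htri hγ0.le, mul_le_mul_of_nonneg_left hle hγ0.le]
    linarith [mul_le_mul_of_nonneg_left hpt hwi]
  have hsum := Finset.sum_le_sum key
  rw [Finset.sum_add_distrib, ← Finset.mul_sum, ← Finset.mul_sum, ← Finset.mul_sum] at hsum
  rw [le_div_iff₀ hγ0]
  linarith [mul_le_mul_of_nonneg_left hdev2 hγ0.le, mul_le_mul_of_nonneg_right hγ1 hε]
end

section
/- Let a, b ∈ ℝ and suppose that for every x ∈ [−1, 1], the value (1/2)·a·x² + b·x lies in [−1, 1]. Then |a| ≤ 2 and |b| ≤ 1. -/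
theorem stmt9 (a b : ℝ)
    (h : ∀ x ∈ Set.Icc (-1 : ℝ) 1, (1 / 2) * a * x ^ 2 + b * x ∈ Set.Icc (-1 : ℝ) 1) :
    |a| ≤ 2 ∧ |b| ≤ 1 := by
  obtain ⟨h₁, h₂⟩ := h 1 (by norm_num)
  obtain ⟨h₃, h₄⟩ := h (-1) (by norm_num)
  constructor <;> rw [abs_le] <;> constructor <;> linarith
end

section
/- Let R ≥ 1, let X ⊆ ℝ^d be a nonempty set contained in the closed Euclidean ball of radius R centered at the origin, let φ : X → ℝ^d, let ε ≥ 0, and let μ be a finitely-supported probability distribution on X. Suppose that for every symmetric matrix A with 0 ⪯ A ⪯ 2·I and every b ∈ ℝ^d with ‖b‖₂ ≤ 1, E_{x∼μ} ⟨b − A x, φ(x) − x⟩ ≤ ε. Then: (1) for every v ∈ ℝ^d with ‖v‖₂ ≤ 1, E_{x∼μ} ⟨v, φ(x) − x⟩ ≤ ε; and (2) for every v ∈ X, E_{x∼μ} ⟨φ(x) − x, v − x⟩ ≤ ε·R. -/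
open scoped InnerProductSpace

theorem stmt11 {d : ℕ} {ι : Type*}
    (R : ℝ) (hR : 1 ≤ R)
    (X : Set (EuclideanSpace ℝ (Fin d))) (hXne : X.Nonempty)
    (hXR : X ⊆ Metric.closedBall 0 R)
    (φ : EuclideanSpace ℝ (Fin d) → EuclideanSpace ℝ (Fin d))
    (ε : ℝ) (hε : 0 ≤ ε)
    (s : Finset ι) (w : ι → ℝ) (p : ι → EuclideanSpace ℝ (Fin d))
    (hw : ∀ i ∈ s, 0 ≤ w i) (hw1 : ∑ i ∈ s, w i = 1)
    (hpX : ∀ i ∈ s, p i ∈ X)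
    (hqefp : ∀ (A : Matrix (Fin d) (Fin d) ℝ), A.IsSymm → A.PosSemidef →
      ((2 : ℝ) • (1 : Matrix (Fin d) (Fin d) ℝ) - A).PosSemidef →
      ∀ b : EuclideanSpace ℝ (Fin d), ‖b‖ ≤ 1 →
      ∑ i ∈ s, w i * ⟪b - Matrix.toEuclideanLin A (p i), φ (p i) - p i⟫_ℝ ≤ ε) :
    (∀ v : EuclideanSpace ℝ (Fin d), ‖v‖ ≤ 1 →
      ∑ i ∈ s, w i * ⟪v, φ (p i) - p i⟫_ℝ ≤ ε) ∧
    (∀ v ∈ X, ∑ i ∈ s, w i * ⟪φ (p i) - p i, v - p i⟫_ℝ ≤ ε * R) := by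
  have psd_smul : ∀ c : ℝ, 0 ≤ c → (c • (1 : Matrix (Fin d) (Fin d) ℝ)).PosSemidef :=
    fun c hc => Matrix.PosSemidef.one.smul hc
  have hR0 : 0 < R := by linarith
  constructor
  · intro v hv
    have h2 := psd_smul 2 (by norm_num)
    have h := hqefp 0 Matrix.isSymm_zero Matrix.PosSemidef.zero (by simpa using h2) v hv
    simpa using h
  · intro v hv
    have hRinv : R⁻¹ ≤ 1 := inv_le_one_of_one_le₀ hR
    have hvR : ‖v‖ ≤ R := by simpa using hXR hv
    have hb : ‖R⁻¹ • v‖ ≤ 1 := by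
      rw [norm_smul, Real.norm_of_nonneg (by positivity), inv_mul_le_iff₀ hR0]
      linarith
    have h := hqefp (R⁻¹ • 1) (Matrix.isSymm_one.smul _) (psd_smul _ (by positivity))
      (by rw [← sub_smul]; exact psd_smul _ (by linarith)) (R⁻¹ • v) hb
    have hsum : ∑ i ∈ s, w i * ⟪R⁻¹ • v - Matrix.toEuclideanLin (R⁻¹ • 1) (p i), φ (p i) - p i⟫_ℝ
        = R⁻¹ * ∑ i ∈ s, w i * ⟪φ (p i) - p i, v - p i⟫_ℝ := by
      rw [Finset.mul_sum]
      refine Finset.sum_congr rfl fun i _ => ?_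
      have hA : Matrix.toEuclideanLin (R⁻¹ • (1 : Matrix (Fin d) (Fin d) ℝ)) (p i)
          = R⁻¹ • p i := by
        ext j
        simp
      rw [hA, ← smul_sub, real_inner_smul_left, real_inner_comm]
      ring
    rw [hsum, inv_mul_le_iff₀ hR0] at h
    linarith
end

section
/- Let X ⊆ ℝ^d be a nonempty set, let f : X → X, let γ ∈ (0,1] and ε ≥ 0, let x* ∈ ℝ^d, and let A be a symmetric positive semidefinite d×d real matrix. Define Q(x) = ⟨A(x − x*), x − x*⟩ and suppose 0 ≤ Q(x) ≤ 1 for all x ∈ X, and Q(f(x)) ≤ (1 − γ)·Q(x) for all x ∈ X. Let μ be a finitely-supported probability distribution on X such that for every function u : ℝ^d → ℝ of the form u(x) = ⟨b, x⟩ − (1/2)·⟨B x, x⟩ + c with B symmetric positive semidefinite, whose values on X lie in [0,1], it holds that E_{x∼μ}[u(f(x)) − u(x)] ≤ ε. Then E_{x∼μ} Q(x) ≤ ε/γ. -/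
open scoped InnerProductSpace

/-- One minus the squared Mahalanobis distance, expanded as an affine function minus a quadratic
form. -/
theorem one_sub_inner_toEuclideanLin_sub {d : ℕ} {A : Matrix (Fin d) (Fin d) ℝ}
    (hA : A.IsHermitian) (x y : EuclideanSpace ℝ (Fin d)) :
    1 - ⟪Matrix.toEuclideanLin A (x - y), x - y⟫_ℝ =
      ⟪(2 : ℝ) • Matrix.toEuclideanLin A y, x⟫_ℝ
        - (1 / 2) * ⟪Matrix.toEuclideanLin ((2 : ℝ) • A) x, x⟫_ℝ
        + (1 - ⟪Matrix.toEuclideanLin A y, y⟫_ℝ) := by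
  have hsymm : ⟪Matrix.toEuclideanLin A x, y⟫_ℝ = ⟪Matrix.toEuclideanLin A y, x⟫_ℝ := by
    rw [Matrix.isSymmetric_toEuclideanLin_iff.mpr hA x y, real_inner_comm]
  simp only [map_sub, map_smul, LinearMap.smul_apply, inner_sub_left, inner_sub_right,
    real_inner_smul_left, hsymm]
  ring

theorem stmt18 {d : ℕ} {ι : Type*}
    (X : Set (EuclideanSpace ℝ (Fin d))) (hXne : X.Nonempty)
    (f : EuclideanSpace ℝ (Fin d) → EuclideanSpace ℝ (Fin d)) (hf : ∀ x ∈ X, f x ∈ X)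
    (γ ε : ℝ) (hγ0 : 0 < γ) (hγ1 : γ ≤ 1) (hε : 0 ≤ ε)
    (xstar : EuclideanSpace ℝ (Fin d))
    (A : Matrix (Fin d) (Fin d) ℝ) (hA : A.IsSymm) (hApsd : A.PosSemidef)
    (Q : EuclideanSpace ℝ (Fin d) → ℝ)
    (hQdef : ∀ x : EuclideanSpace ℝ (Fin d),
      Q x = ⟪Matrix.toEuclideanLin A (x - xstar), x - xstar⟫_ℝ)
    (hQ01 : ∀ x ∈ X, Q x ∈ Set.Icc (0 : ℝ) 1)
    (hcontr : ∀ x ∈ X, Q (f x) ≤ (1 - γ) * Q x)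
    (s : Finset ι) (w : ι → ℝ) (p : ι → EuclideanSpace ℝ (Fin d))
    (hw : ∀ i ∈ s, 0 ≤ w i) (hw1 : ∑ i ∈ s, w i = 1)
    (hpX : ∀ i ∈ s, p i ∈ X)
    (hqefp : ∀ (B : Matrix (Fin d) (Fin d) ℝ), B.IsSymm → B.PosSemidef →
      ∀ (b : EuclideanSpace ℝ (Fin d)) (c : ℝ),
      ∀ u : EuclideanSpace ℝ (Fin d) → ℝ,
      (∀ x : EuclideanSpace ℝ (Fin d),
        u x = ⟪b, x⟫_ℝ - (1 / 2) * ⟪Matrix.toEuclideanLin B x, x⟫_ℝ + c) →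
      (∀ x ∈ X, u x ∈ Set.Icc (0 : ℝ) 1) →
      ∑ i ∈ s, w i * (u (f (p i)) - u (p i)) ≤ ε) :
    ∑ i ∈ s, w i * Q (p i) ≤ ε / γ := by
  have hgain := hqefp ((2 : ℝ) • A) (hA.smul 2) (hApsd.smul zero_le_two)
    ((2 : ℝ) • Matrix.toEuclideanLin A xstar)
    (1 - ⟪Matrix.toEuclideanLin A xstar, xstar⟫_ℝ) (fun x => 1 - Q x)
    (fun x => by rw [hQdef, one_sub_inner_toEuclideanLin_sub hApsd.isHermitian])
    (fun x hx => ⟨sub_nonneg.mpr (hQ01 x hx).2, sub_le_self 1 (hQ01 x hx).1⟩)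
  rw [le_div_iff₀ hγ0, Finset.sum_mul]
  refine (Finset.sum_le_sum fun i hi => ?_).trans hgain
  rw [mul_assoc]
  exact mul_le_mul_of_nonneg_left (by linarith [hcontr (p i) (hpX i hi)]) (hw i hi)
end
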